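/- Let D ⊆ {0,1}^n, let f : D → {0,1} be a nonconstant partial Boolean function, let C ⊆ f⁻¹(1) be nonempty, and let T be a decision tree. There exists a probability distribution 𝒟 supported on C together with all sensitive neighbors of points of C such that for all r ≥ 1, error_{𝒟^{⊗r}}(T, f^{⊕r}) ≥ (1 / (2|C| · Sens(f)))^r · Σ_{x ∈ C^r : Sens(f^{⊕r}_{π(x)}, x) ≠ ∅} Π_{i=1}^r max{1, |Sens(f_{π(x)^{(i)}}, x^{(i)})|}, where π(x) is the restriction given by the path followed by x in T and π(x)^{(i)} is its part touching the i-th block of variables. -/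

import Mathlib

open Finset

attribute [local instance] Classical.propDecidable

/-- A binary decision tree querying coordinates of type `ι`. -/
inductive DTree (ι : Type) : Type where
  | leaf : Bool → DTree ι
  | node : ι → DTree ι → DTree ι → DTree ι

namespace DTree

/-- Evaluation of a decision tree on an input. -/
def eval {ι : Type} : DTree ι → (ι → Bool) → Bool
  | .leaf b, _ => b
  | .node i t0 t1, x => if x i then t1.eval x else t0.eval x

/-- The size of a decision tree is its number of leaves. -/
def size {ι : Type} : DTree ι → ℕ
  | .leaf _ => 1
  | .node _ t0 t1 => t0.size + t1.size

/-- The restriction (set of literals) given by the root-to-leaf path followed by `x` in `T`. -/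
noncomputable def pathRes {ι : Type} : DTree ι → (ι → Bool) → (ι → Option Bool)
  | .leaf _, _ => fun _ => none
  | .node i t0 t1, x =>
      Function.update (if x i then t1.pathRes x else t0.pathRes x) i (some (x i))

end DTree

/-- Apply a restriction to an input: coordinates fixed by `ρ` take their fixed value. -/
def override {ι : Type} (ρ : ι → Option Bool) (x : ι → Bool) : ι → Bool :=
  fun i => (ρ i).getD (x i)

/-- The number of literals in a restriction. -/
noncomputable def resSize {ι : Type} [Fintype ι] (ρ : ι → Option Bool) : ℕ :=
  (Finset.univ.filter fun i => (ρ i).isSome).card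

/-- A restriction `ρ` is consistent with the input `x`. -/
def Consistent {ι : Type} (ρ : ι → Option Bool) (x : ι → Bool) : Prop :=
  ∀ i b, ρ i = some b → x i = b

/-- `T` computes the partial function (represented by the total function `f`) on domain `D`. -/
def Computes {ι : Type} (T : DTree ι) (f : (ι → Bool) → Bool) (D : Finset (ι → Bool)) : Prop :=
  ∀ x ∈ D, T.eval x = f x

/-- `DT(f)`: the minimal size of a decision tree computing the partial function `f : D → {0,1}`. -/
noncomputable def DTsize {ι : Type} (f : (ι → Bool) → Bool) (D : Finset (ι → Bool)) : ℕ :=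
  sInf {s | ∃ T : DTree ι, Computes T f D ∧ T.size = s}

/-- The domain of the subfunction `f_ρ`: inputs whose `ρ`-override lies in `D`. -/
noncomputable def restrictD {ι : Type} [Fintype ι] (D : Finset (ι → Bool)) (ρ : ι → Option Bool) :
    Finset (ι → Bool) :=
  Finset.univ.filter fun x => override ρ x ∈ D

/-- The subfunction `f_ρ` of `f` obtained by fixing variables according to `ρ`. -/
def restrictF {ι : Type} (f : (ι → Bool) → Bool) (ρ : ι → Option Bool) : (ι → Bool) → Bool :=
  fun x => f (override ρ x)

/-- The partial function `f : D → {0,1}` is constant on its domain. -/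
def IsConstOn {ι : Type} (f : (ι → Bool) → Bool) (D : Finset (ι → Bool)) : Prop :=
  ∀ x ∈ D, ∀ y ∈ D, f x = f y

/-- `Cert(f, x)`: the minimal number of literals of a restriction `ρ` consistent with `x`
such that `f_ρ` is constant on its domain. -/
noncomputable def Cert {ι : Type} [Fintype ι] (f : (ι → Bool) → Bool) (D : Finset (ι → Bool))
    (x : ι → Bool) : ℕ :=
  sInf {k | ∃ ρ : ι → Option Bool, Consistent ρ x ∧
    IsConstOn (restrictF f ρ) (restrictD D ρ) ∧ resSize ρ = k}

/-- `x` with bit `i` flipped. -/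
noncomputable def flipBit {ι : Type} (x : ι → Bool) (i : ι) : ι → Bool :=
  Function.update x i (!(x i))

/-- `Sens(f, x)`: the set of sensitive neighbors of `x` that lie in the domain `D`. -/
noncomputable def sensSet {ι : Type} [Fintype ι] (f : (ι → Bool) → Bool) (D : Finset (ι → Bool))
    (x : ι → Bool) : Finset (ι → Bool) :=
  D.filter fun y => (∃ i, y = flipBit x i) ∧ f y ≠ f x

/-- `Sens(f)`: the maximum sensitivity of the partial function `f : D → {0,1}`. -/
noncomputable def maxSens {ι : Type} [Fintype ι] (f : (ι → Bool) → Bool)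
    (D : Finset (ι → Bool)) : ℕ :=
  D.sup fun x => (sensSet f D x).card

/-- `error_𝒟(T, f) = Pr_{x ∼ 𝒟}[T(x) ≠ f(x)]`, for a distribution given by its
probability mass function `𝒟`. -/
noncomputable def errD {ι : Type} [Fintype ι] (𝒟 : (ι → Bool) → ℝ) (T : DTree ι)
    (f : (ι → Bool) → Bool) : ℝ :=
  ∑ x : ι → Bool, 𝒟 x * (if T.eval x = f x then 0 else 1)

/-- XOR of a finite family of bits. -/
noncomputable def xorAll {r : ℕ} (g : Fin r → Bool) : Bool :=
  decide (Odd (Finset.univ.filter fun i => g i = true).card)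

/-- Combine a tuple of `r` inputs into a single input on `r` disjoint blocks of `n` variables. -/
def glue {n r : ℕ} (x : Fin r → (Fin n → Bool)) : Fin r × Fin n → Bool :=
  fun p => x p.1 p.2

/-- `f^{⊕r}`: the `r`-fold XOR of `f`, as a function on `r` disjoint blocks of `n` variables. -/
noncomputable def xorFun (r : ℕ) {n : ℕ} (f : (Fin n → Bool) → Bool) :
    (Fin r × Fin n → Bool) → Bool :=
  fun z => xorAll fun i => f fun j => z (i, j)

/-- `D^r`: the domain of `f^{⊕r}`. -/
noncomputable def prodDom (r : ℕ) {n : ℕ} (D : Finset (Fin n → Bool)) :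
    Finset (Fin r × Fin n → Bool) :=
  Finset.univ.filter fun z => ∀ i : Fin r, (fun j => z (i, j)) ∈ D

/-- The part of a restriction touching the `i`-th block of variables. -/
def blockRes {n r : ℕ} (ρ : Fin r × Fin n → Option Bool) (i : Fin r) : Fin n → Option Bool :=
  fun j => ρ (i, j)

theorem DTree.pathRes_consistent {ι : Type} (T : DTree ι) (x : ι → Bool) :
    Consistent (T.pathRes x) x := by
  induction T with
  | leaf b => intro i b h; simp [DTree.pathRes] at h
  | node j t0 t1 h0 h1 =>
    intro i b h
    by_cases hij : i = j
    · subst hij; simpa [DTree.pathRes] using h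
    · rw [DTree.pathRes, Function.update_of_ne hij] at h
      split_ifs at h
      · exact h1 i b h
      · exact h0 i b h

/-- An input agreeing with `x` on the path followed by `x` reaches the same leaf as `x`. -/
theorem DTree.eval_eq_of_agree {ι : Type} (T : DTree ι) (x z : ι → Bool)
    (h : ∀ i, (T.pathRes x i).isSome → z i = x i) : T.eval z = T.eval x := by
  induction T with
  | leaf b => rfl
  | node j t0 t1 h0 h1 =>
    have hj : z j = x j := h j (by simp [DTree.pathRes])
    have hsub : ∀ i, ((if x j then t1.pathRes x else t0.pathRes x) i).isSome → z i = x i := by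
      intro i hi
      by_cases hij : i = j
      · rw [hij, hj]
      · exact h i (by rwa [DTree.pathRes, Function.update_of_ne hij])
    simp only [DTree.eval, hj]
    split_ifs with hx
    · exact h1 (by simpa [hx] using hsub)
    · exact h0 (by simpa [hx] using hsub)

theorem override_eq_self_of_agree {ι : Type} {ρ : ι → Option Bool} {x y : ι → Bool}
    (hc : Consistent ρ x) (h : ∀ i, (ρ i).isSome → y i = x i) : override ρ y = y := by
  funext i
  cases hi : ρ i with
  | none => simp [override, hi]
  | some b => simp [override, hi, h i (by simp [hi]), hc i b hi]

theorem override_flipBit_of_isSome {ι : Type} {ρ : ι → Option Bool} {x : ι → Bool}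
    (hc : Consistent ρ x) {j : ι} (hj : (ρ j).isSome) : override ρ (flipBit x j) = x := by
  funext i
  cases hi : ρ i with
  | none =>
    have hij : i ≠ j := by rintro rfl; simp [hi] at hj
    simp [override, hi, flipBit, hij]
  | some b => simp [override, hi, hc i b hi]

/-- The sensitive neighbors of `x` in a subfunction `f_ρ` consistent with `x` are the sensitive
neighbors in `f` obtained by flipping a coordinate that `ρ` leaves free. -/
theorem mem_sensSet_restrict {ι : Type} [Fintype ι] {f : (ι → Bool) → Bool}
    {D : Finset (ι → Bool)} {ρ : ι → Option Bool} {x y : ι → Bool} (hc : Consistent ρ x) :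
    y ∈ sensSet (restrictF f ρ) (restrictD D ρ) x ↔
      y ∈ sensSet f D x ∧ ∀ i, (ρ i).isSome → y i = x i := by
  have hx : override ρ x = x := override_eq_self_of_agree hc fun _ _ => rfl
  simp only [sensSet, restrictF, restrictD, mem_filter, mem_univ, true_and, hx]
  constructor
  · rintro ⟨hD, ⟨j, rfl⟩, hne⟩
    have hj : ¬ (ρ j).isSome := fun hj => hne (by rw [override_flipBit_of_isSome hc hj])
    have hagree : ∀ i, (ρ i).isSome → flipBit x j i = x i := by
      intro i hi
      have hij : i ≠ j := by rintro rfl; exact hj hi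
      simp [flipBit, hij]
    rw [override_eq_self_of_agree hc hagree] at hD hne
    exact ⟨⟨hD, ⟨j, rfl⟩, hne⟩, hagree⟩
  · rintro ⟨⟨hD, hj, hne⟩, hagree⟩
    rw [override_eq_self_of_agree hc hagree]
    exact ⟨hD, hj, hne⟩

theorem xorAll_ne_of_lt {r : ℕ} {g h : Fin r → Bool} {i : Fin r} (hg : g i = true)
    (hh : h i = false) (heq : ∀ j, j ≠ i → g j = h j) : xorAll g ≠ xorAll h := by
  have hins : (univ.filter fun j => g j = true) = insert i (univ.filter fun j => h j = true) := by
    ext j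
    by_cases hj : j = i
    · simp [hj, hg]
    · simp [hj, heq j hj]
  have hcard : (univ.filter fun j => g j = true).card =
      (univ.filter fun j => h j = true).card + 1 := by
    rw [hins, card_insert_of_notMem (by simp [hh])]
  simp only [xorAll, hcard, Nat.odd_add_one, ne_eq, decide_eq_decide]
  tauto

/-- Changing exactly one of the bits changes their XOR. -/
theorem xorAll_ne {r : ℕ} {g h : Fin r → Bool} {i : Fin r} (hi : g i ≠ h i)
    (heq : ∀ j, j ≠ i → g j = h j) : xorAll g ≠ xorAll h := by
  cases hg : g i with
  | true => exact xorAll_ne_of_lt hg (by simpa [hg] using hi) heq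
  | false =>
    exact (xorAll_ne_of_lt (by simpa [hg] using hi) hg fun j hj => (heq j hj).symm).symm

theorem xorFun_glue {n r : ℕ} (f : (Fin n → Bool) → Bool) (x : Fin r → Fin n → Bool) :
    xorFun r f (glue x) = xorAll fun i => f (x i) := rfl

theorem blockRes_consistent {n r : ℕ} {ρ : Fin r × Fin n → Option Bool}
    {x : Fin r → Fin n → Bool} (hc : Consistent ρ (glue x)) (i : Fin r) :
    Consistent (blockRes ρ i) (x i) :=
  fun j b h => hc (i, j) b h

/-- A sensitive neighbor of a tuple for the XOR yields a sensitive neighbor in some block. -/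
theorem exists_block_sensSet_nonempty {n r : ℕ} {D : Finset (Fin n → Bool)}
    {f : (Fin n → Bool) → Bool} {ρ : Fin r × Fin n → Option Bool} {x : Fin r → Fin n → Bool}
    (hc : Consistent ρ (glue x))
    (h : (sensSet (restrictF (xorFun r f) ρ) (restrictD (prodDom r D) ρ) (glue x)).Nonempty) :
    ∃ i, (sensSet (restrictF f (blockRes ρ i)) (restrictD D (blockRes ρ i)) (x i)).Nonempty := by
  obtain ⟨y, hy⟩ := h
  rw [mem_sensSet_restrict hc] at hy
  obtain ⟨hy, hagree⟩ := hy
  simp only [sensSet, prodDom, mem_filter, mem_univ, true_and] at hy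
  obtain ⟨hD, ⟨⟨i, j⟩, hij⟩, hne⟩ := hy
  have hblock : (fun k => y (i, k)) = flipBit (x i) j := by
    funext k
    by_cases hk : k = j <;> simp [hij, flipBit, glue, hk]
  have hother : ∀ i', i' ≠ i → (fun k => y (i', k)) = x i' := by
    intro i' hi'
    funext k
    simp [hij, flipBit, glue, hi']
  refine ⟨i, fun k => y (i, k), (mem_sensSet_restrict (blockRes_consistent hc i)).2
    ⟨?_, fun k hk => hagree (i, k) hk⟩⟩
  simp only [sensSet, mem_filter]
  refine ⟨hD i, ⟨j, hblock⟩, fun heq => hne ?_⟩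
  rw [xorFun_glue]
  unfold xorFun
  congr 1
  funext i'
  by_cases hi' : i' = i
  · subst hi'; exact heq
  · rw [hother i' hi']

/-- The distribution giving mass `c` to every sensitive neighbor of `x`, and the rest to `x`. -/
noncomputable def sensWeight {n : ℕ} (f : (Fin n → Bool) → Bool) (D : Finset (Fin n → Bool))
    (c : ℝ) (x z : Fin n → Bool) : ℝ :=
  (if z = x then 1 - (sensSet f D x).card * c else 0) + if z ∈ sensSet f D x then c else 0

theorem sum_sensWeight {n : ℕ} (f : (Fin n → Bool) → Bool) (D : Finset (Fin n → Bool))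
    (c : ℝ) (x : Fin n → Bool) : ∑ z, sensWeight f D c x z = 1 := by
  simp [sensWeight, sum_add_distrib, sum_ite_mem]

theorem sensWeight_self {n : ℕ} (f : (Fin n → Bool) → Bool) (D : Finset (Fin n → Bool))
    (c : ℝ) (x : Fin n → Bool) : sensWeight f D c x x = 1 - (sensSet f D x).card * c := by
  simp [sensWeight, sensSet]

theorem sensWeight_of_mem {n : ℕ} {f : (Fin n → Bool) → Bool} {D : Finset (Fin n → Bool)}
    (c : ℝ) {x z : Fin n → Bool} (hz : z ∈ sensSet f D x) : sensWeight f D c x z = c := by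
  have hne : z ≠ x := by rintro rfl; simp [sensSet] at hz
  simp [sensWeight, hz, hne]

theorem sensWeight_nonneg {n : ℕ} {f : (Fin n → Bool) → Bool} {D : Finset (Fin n → Bool)}
    {c : ℝ} {x : Fin n → Bool} (hc : 0 ≤ c) (h : (sensSet f D x).card * c ≤ 1)
    (z : Fin n → Bool) : 0 ≤ sensWeight f D c x z := by
  unfold sensWeight
  split_ifs <;> linarith

theorem card_sensSet_le_maxSens {ι : Type} [Fintype ι] (f : (ι → Bool) → Bool)
    {D : Finset (ι → Bool)} {x : ι → Bool} (hx : x ∈ D) :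
    (sensSet f D x).card ≤ maxSens f D :=
  le_sup (f := fun x => (sensSet f D x).card) hx

theorem sum_eq_sum_glue {n r : ℕ} (I : Fintype (Fin r × Fin n → Bool))
    (g : (Fin r × Fin n → Bool) → ℝ) :
    ∑ z ∈ @univ _ I, g z = ∑ z : Fin r → Fin n → Bool, g (glue z) :=
  ((Equiv.curry (Fin r) (Fin n) Bool).symm.sum_comp g).symm

/-- The error of `T` under a product of mixtures is the average of the errors under the products
of the components. -/
theorem errD_prod_mixture {n r : ℕ} (C : Finset (Fin n → Bool))
    (w : (Fin n → Bool) → (Fin n → Bool) → ℝ) (a : ℝ) (T : DTree (Fin r × Fin n))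
    (F : (Fin r × Fin n → Bool) → Bool) :
    errD (fun z : Fin r × Fin n → Bool => ∏ i, (a * ∑ x ∈ C, w x fun j => z (i, j))) T F =
      a ^ r * ∑ x ∈ Fintype.piFinset fun _ : Fin r => C, ∑ z : Fin r → Fin n → Bool,
        (∏ i, w (x i) (z i)) * (if T.eval (glue z) = F (glue z) then 0 else 1) := by
  unfold errD
  refine (sum_eq_sum_glue _ _).trans ?_
  rw [sum_comm, mul_sum]
  refine sum_congr rfl fun z _ => ?_
  rw [← sum_mul, ← prod_univ_sum (fun _ : Fin r => C) fun i x => w x (z i), ← mul_assoc]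
  congr 1
  simp [prod_mul_distrib, glue]

theorem prod_le_error_of_forall_sum {n r : ℕ} {μ : Fin r → (Fin n → Bool) → ℝ}
    (hμ : ∀ i z, 0 ≤ μ i z) {m : Fin r → ℝ} (hm : ∀ i, 0 ≤ m i)
    (T : DTree (Fin r × Fin n)) (F : (Fin r × Fin n → Bool) → Bool)
    (Z : Fin r → Finset (Fin n → Bool))
    (herr : ∀ z, (∀ i, z i ∈ Z i) → T.eval (glue z) ≠ F (glue z))
    (hZ : ∀ i, m i ≤ ∑ z ∈ Z i, μ i z) :
    ∏ i, m i ≤ ∑ z : Fin r → Fin n → Bool,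
      (∏ i, μ i (z i)) * (if T.eval (glue z) = F (glue z) then 0 else 1) := by
  calc ∏ i, m i ≤ ∏ i, ∑ z ∈ Z i, μ i z := prod_le_prod (fun i _ => hm i) fun i _ => hZ i
    _ = ∑ z ∈ Fintype.piFinset Z, ∏ i, μ i (z i) := prod_univ_sum _ _
    _ = ∑ z ∈ Fintype.piFinset Z,
          (∏ i, μ i (z i)) * (if T.eval (glue z) = F (glue z) then 0 else 1) := by
        refine sum_congr rfl fun z hz => ?_
        rw [if_neg (herr z (Fintype.mem_piFinset.1 hz)), mul_one]
    _ ≤ _ := by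
        refine sum_le_sum_of_subset_of_nonneg (subset_univ _) fun z _ _ => ?_
        exact mul_nonneg (prod_nonneg fun i _ => hμ i _) (by split_ifs <;> norm_num)

/-- The error of `T` on the product of the distributions `sensWeight f D c (x i)`, when `x` has a
sensitive neighbor left after following its path in `T`. -/
theorem prod_max_le_error_sensWeight {n r : ℕ} {D : Finset (Fin n → Bool)}
    {f : (Fin n → Bool) → Bool} {c : ℝ} (hc0 : 0 ≤ c) (hc : c ≤ 1 / 2)
    {x : Fin r → Fin n → Bool} (hx : ∀ i, (sensSet f D (x i)).card * c ≤ 1 / 2)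
    (T : DTree (Fin r × Fin n))
    (h : (sensSet (restrictF (xorFun r f) (T.pathRes (glue x)))
      (restrictD (prodDom r D) (T.pathRes (glue x))) (glue x)).Nonempty) :
    ∏ i, (c * max 1 ((sensSet (restrictF f (blockRes (T.pathRes (glue x)) i))
        (restrictD D (blockRes (T.pathRes (glue x)) i)) (x i)).card : ℝ)) ≤
      ∑ z : Fin r → Fin n → Bool, (∏ i, sensWeight f D c (x i) (z i)) *
        (if T.eval (glue z) = xorFun r f (glue z) then 0 else 1) := by
  have hcons := T.pathRes_consistent (glue x)
  obtain ⟨i₀, hi₀⟩ := exists_block_sensSet_nonempty hcons h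
  set S := fun i => sensSet (restrictF f (blockRes (T.pathRes (glue x)) i))
    (restrictD D (blockRes (T.pathRes (glue x)) i)) (x i)
  have hmem : ∀ i z, z ∈ S i ↔ z ∈ sensSet f D (x i) ∧
      ∀ j, (T.pathRes (glue x) (i, j)).isSome → z j = x i j :=
    fun i z => mem_sensSet_restrict (blockRes_consistent hcons i)
  have hself : ∀ i, c * max 1 ((S i).card : ℝ) ≤ sensWeight f D c (x i) (x i) := by
    intro i
    have hle : ((S i).card : ℝ) ≤ (sensSet f D (x i)).card := by
      exact_mod_cast card_le_card fun z hz => ((hmem i z).1 hz).1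
    rw [sensWeight_self, mul_max_of_nonneg _ _ hc0]
    refine max_le ?_ ?_
    · linarith [hx i]
    · nlinarith [hx i]
  have hbound := prod_le_error_of_forall_sum (μ := fun i => sensWeight f D c (x i))
    (m := fun i => c * max 1 ((S i).card : ℝ))
    (fun i z => sensWeight_nonneg hc0 ((hx i).trans (by norm_num)) z)
    (fun i => mul_nonneg hc0 (zero_le_one.trans (le_max_left _ _))) T (xorFun r f)
  by_cases hT : T.eval (glue x) = xorFun r f (glue x)
  · refine hbound (Function.update (fun i => {x i}) i₀ (S i₀)) ?_ ?_
    · intro z hz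
      have hz₀ : z i₀ ∈ S i₀ := by simpa using hz i₀
      have hz' : ∀ i, i ≠ i₀ → z i = x i := fun i hi => by simpa [hi] using hz i
      obtain ⟨hsens, hagree⟩ := (hmem _ _).1 hz₀
      rw [T.eval_eq_of_agree (glue x) (glue z), hT, xorFun_glue, xorFun_glue]
      · refine xorAll_ne (i := i₀) ?_ fun i hi => by rw [hz' i hi]
        simp only [sensSet, mem_filter] at hsens
        exact hsens.2.2.symm
      · rintro ⟨i, j⟩ hij
        by_cases hi : i = i₀
        · subst hi; exact hagree j hij
        · simp [glue, hz' i hi]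
    · intro i
      by_cases hi : i = i₀
      · subst hi
        have hcard : (1 : ℝ) ≤ (S i).card := by exact_mod_cast hi₀.card_pos
        rw [Function.update_self,
          sum_congr rfl fun z hz => sensWeight_of_mem c ((hmem i z).1 hz).1, sum_const,
          nsmul_eq_mul, max_eq_right hcard, mul_comm]
      · simpa [hi] using hself i
  · refine hbound (fun i => {x i}) ?_ fun i => by simpa using hself i
    intro z hz
    obtain rfl : z = x := funext fun i => by simpa using hz i
    exact hT

/-- XOR-ed hard distribution lemma: for a nonconstant partial function
`f : D → {0,1}` and nonempty `C ⊆ f⁻¹(1)`, there is a distribution `𝒟` supported on `C`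
together with all sensitive neighbors of points of `C` such that for all `r ≥ 1` and every
decision tree `T`,
`error_{𝒟^{⊗r}}(T, f^{⊕r}) ≥ (1/(2|C|·Sens(f)))^r ·
Σ_{x ∈ C^r, Sens(f^{⊕r}_{π(x)}, x) ≠ ∅} Π_{i=1}^r max{1, |Sens(f_{π(x)⁽ⁱ⁾}, x⁽ⁱ⁾)|}`. -/
theorem stmt7 {n : ℕ} (D : Finset (Fin n → Bool)) (f : (Fin n → Bool) → Bool)
    (hnc : ∃ x ∈ D, ∃ y ∈ D, f x ≠ f y)
    (C : Finset (Fin n → Bool)) (hC : ∀ x ∈ C, x ∈ D ∧ f x = true) (hCne : C.Nonempty) :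
    ∃ 𝒟 : (Fin n → Bool) → ℝ, (∀ z, 0 ≤ 𝒟 z) ∧ (∑ z, 𝒟 z) = 1 ∧
      (∀ z, 𝒟 z ≠ 0 → z ∈ C ∪ C.biUnion fun x => sensSet f D x) ∧
      ∀ r : ℕ, 1 ≤ r → ∀ T : DTree (Fin r × Fin n),
        ((1 : ℝ) / (2 * (C.card : ℝ) * (maxSens f D : ℝ))) ^ r *
          ∑ x ∈ (Finset.univ.filter fun x : Fin r → (Fin n → Bool) =>
              (∀ i, x i ∈ C) ∧
              (sensSet (restrictF (xorFun r f) (T.pathRes (glue x)))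
                  (restrictD (prodDom r D) (T.pathRes (glue x))) (glue x)).Nonempty),
            ∏ i, max 1 ((sensSet (restrictF f (blockRes (T.pathRes (glue x)) i))
                  (restrictD D (blockRes (T.pathRes (glue x)) i)) (x i)).card : ℝ)
        ≤ errD (fun z : Fin r × Fin n → Bool => ∏ i, 𝒟 fun j => z (i, j)) T (xorFun r f) := by
  set s := maxSens f D
  set c : ℝ := 1 / (2 * s) with hc
  have hc0 : 0 ≤ c := by positivity
  have hsc : (s : ℝ) * c ≤ 1 / 2 := by
    rcases Nat.eq_zero_or_pos s with h0 | h0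
    · simp [h0]
    · have : (0 : ℝ) < s := by exact_mod_cast h0
      rw [hc]; field_simp; rfl
  have hcard : ∀ x ∈ C, ((sensSet f D x).card : ℝ) * c ≤ 1 / 2 := fun x hx =>
    (mul_le_mul_of_nonneg_right
      (by exact_mod_cast card_sensSet_le_maxSens f (hC x hx).1) hc0).trans hsc
  have hCpos : (0 : ℝ) < C.card := by exact_mod_cast hCne.card_pos
  have hw : ∀ x ∈ C, ∀ z, 0 ≤ sensWeight f D c x z := fun x hx =>
    sensWeight_nonneg hc0 ((hcard x hx).trans (by norm_num))
  refine ⟨fun z => (C.card : ℝ)⁻¹ * ∑ x ∈ C, sensWeight f D c x z, fun z =>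
    mul_nonneg (by positivity) (sum_nonneg fun x hx => hw x hx z), ?_, ?_, ?_⟩
  · rw [← mul_sum, sum_comm, sum_congr rfl fun x _ => sum_sensWeight f D c x]
    simp [hCpos.ne']
  · intro z hz
    obtain ⟨x, hx, hxz⟩ := exists_ne_zero_of_sum_ne_zero (right_ne_zero_of_mul hz)
    rw [mem_union, mem_biUnion]
    by_cases hzx : z = x
    · exact Or.inl (hzx ▸ hx)
    · refine Or.inr ⟨x, hx, ?_⟩
      by_contra hmem
      exact hxz (by simp [sensWeight, hzx, hmem])
  · intro r hr T
    have hpow : ((1 : ℝ) / (2 * (C.card : ℝ) * (s : ℝ))) ^ r = (C.card : ℝ)⁻¹ ^ r * c ^ r := by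
      rw [← mul_pow, hc]
      congr 1
      rw [one_div, one_div, mul_inv, mul_inv, mul_inv]
      ring
    rw [errD_prod_mixture, hpow, mul_assoc, mul_sum]
    refine mul_le_mul_of_nonneg_left ?_ (by positivity)
    have hc2 : c ≤ 1 / 2 := by
      rcases Nat.eq_zero_or_pos s with h0 | h0
      · simp [hc, h0]
      · have : (1 : ℝ) ≤ s := by exact_mod_cast h0
        nlinarith
    refine (sum_le_sum fun x hx => ?_).trans (sum_le_sum_of_subset_of_nonneg ?_ ?_)
    · rw [mem_filter] at hx
      have := prod_max_le_error_sensWeight hc0 hc2 (fun i => hcard _ (hx.2.1 i)) T hx.2.2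
      rwa [prod_mul_distrib, prod_const, card_univ, Fintype.card_fin] at this
    · intro x hx
      exact Fintype.mem_piFinset.2 (mem_filter.1 hx).2.1
    · intro x hx _
      exact sum_nonneg fun z _ => mul_nonneg
        (prod_nonneg fun i _ => hw _ (Fintype.mem_piFinset.1 hx i) _)
        (by split_ifs <;> norm_num)
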